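/- Fix d ≥ 1. For all sufficiently large n the following holds. Suppose the degree-d polynomial f(x) = Σ_{multisets S ⊆ [2n], |S| ≤ d} c_S ∏_{i∈S} x_i has weight(f) > 0 and passes the dictator test T_d with probability at least 1/2 + β, where β = 1/log n. Then |I_{0.5}(f_1)| ≤ 1/β² and |I_1(f_2)| ≤ 1/β², and moreover every i ∈ [n] such that n+i ∈ I_1(f_2) also satisfies i ∈ I_{0.5}(f_1). -/

import Mathlib

open MeasureTheory ProbabilityTheory Real
open scoped ENNReal NNReal

/-- Evaluation of a polynomial given by its (finitely supported) coefficient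
function on multisets of variable indices. -/
noncomputable def polyEval {ι : Type*} (c : Multiset ι →₀ ℝ) (x : ι → ℝ) : ℝ :=
  ∑ S ∈ c.support, c S * (S.map x).prod

/-- Bernoulli measure on `Bool` with `Pr[true] = p`. -/
noncomputable def bernoulliBool (p : ℝ) : Measure Bool :=
  ENNReal.ofReal p • Measure.dirac true + ENNReal.ofReal (1 - p) • Measure.dirac false

/-- Uniform measure on the signs `{-1, 1} ⊆ ℝ`. -/
noncomputable def signUnif : Measure ℝ :=
  (2 : ℝ≥0∞)⁻¹ • Measure.dirac 1 + (2 : ℝ≥0∞)⁻¹ • Measure.dirac (-1)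

/-- Product of `n` independent standard Gaussians. -/
noncomputable def stdGaussianPi (n : ℕ) : Measure (Fin n → ℝ) :=
  Measure.pi fun _ => gaussianReal 0 1

/-- The sample distribution of the dictator test `T_d`: `n` independent
Bernoulli(β) bits `a`, two vectors `h, g` of `n` i.i.d. standard Gaussians, and a
uniform random sign `b ∈ {-1, 1}`, where `β = 1 / log n`. -/
noncomputable def TdMeasure (n : ℕ) :
    Measure ((Fin n → Bool) × (Fin n → ℝ) × (Fin n → ℝ) × ℝ) :=
  (Measure.pi fun _ : Fin n => bernoulliBool (1 / Real.log n)).prod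
    ((stdGaussianPi n).prod ((stdGaussianPi n).prod signUnif))

/-- The query point `y ∈ ℝ^{2n}` of the dictator test `T_d`: coordinates are
indexed by `Fin n ⊕ Fin n` (`Sum.inl i` is coordinate `i`, `Sum.inr i` is
coordinate `n + i`), with `y_i = a_i h_i + g_i ^ d + b δ` and `y_{n+i} = g_i`,
where `δ = 2 ^ (-n²)`. -/
noncomputable def TdPoint (d n : ℕ)
    (ω : (Fin n → Bool) × (Fin n → ℝ) × (Fin n → ℝ) × ℝ) : Fin n ⊕ Fin n → ℝ :=
  Sum.elim
    (fun i => (if ω.1 i then ω.2.1 i else 0) + (ω.2.2.1 i) ^ d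
      + ω.2.2.2 * (2 : ℝ) ^ (-((n : ℤ) ^ 2)))
    fun i => ω.2.2.1 i

/-- The weight of the restriction `f₁` of `f` to the first `n` variables:
the sum of `|c_S|` over nonempty multisets `S` supported on the first half. -/
noncomputable def weightLeft {n : ℕ} (c : Multiset (Fin n ⊕ Fin n) →₀ ℝ) : ℝ :=
  ∑ S ∈ c.support, if S ≠ 0 ∧ ∀ x ∈ S, x.isLeft = true then |c S| else 0

/-- The weight of the restriction `f₂` of `f` to the last `n` variables. -/
noncomputable def weightRight {n : ℕ} (c : Multiset (Fin n ⊕ Fin n) →₀ ℝ) : ℝ :=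
  ∑ S ∈ c.support, if S ≠ 0 ∧ ∀ x ∈ S, x.isRight = true then |c S| else 0

/-- `I_θ(f₁)`: the set of first-half indices `i` such that some monomial `S` of
`f₁` (i.e. supported on the first half) containing `i` has
`|c_S| ≥ θ · weight(f₁) / C(n+d, d)`. -/
def ILeft {n : ℕ} (d : ℕ) (θ : ℝ) (c : Multiset (Fin n ⊕ Fin n) →₀ ℝ) : Set (Fin n) :=
  {i | ∃ S : Multiset (Fin n ⊕ Fin n), Sum.inl i ∈ S ∧ (∀ x ∈ S, x.isLeft = true) ∧
    θ * weightLeft c / (Nat.choose (n + d) d : ℝ) ≤ |c S|}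

/-- `I_θ(f₂)`: the set of indices `i` such that some monomial `S` of `f₂`
(i.e. supported on the second half) containing `n + i` has
`|c_S| ≥ θ · weight(f₂) / C(n+d, d)`. -/
def IRight {n : ℕ} (d : ℕ) (θ : ℝ) (c : Multiset (Fin n ⊕ Fin n) →₀ ℝ) : Set (Fin n) :=
  {i | ∃ S : Multiset (Fin n ⊕ Fin n), Sum.inr i ∈ S ∧ (∀ x ∈ S, x.isRight = true) ∧
    θ * weightRight c / (Nat.choose (n + d) d : ℝ) ≤ |c S|}

/-- `weight(f) = Σ_{S ≠ ∅} |c_S|`. -/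
noncomputable def weight {ι : Type*} [DecidableEq ι] (c : Multiset ι →₀ ℝ) : ℝ :=
  ∑ S ∈ c.support, if S = 0 then 0 else |c S|

section helpers
open Polynomial

lemma uni_coeff (μ : Measure ℝ) (ρ : ℝ) (hρ : 0 < ρ)
    (hμ : ∀ x, μ (Metric.closedBall x ρ) ≤ ENNReal.ofReal (2 * ρ)) (M : ℝ) (hM : 0 ≤ M) (s : ℝ) :
    ∀ (D : ℕ) (P : ℝ[X]), P.natDegree ≤ D → ∀ ε : ℝ, 0 ≤ ε → ∀ E : Set ℝ,
      (D : ℝ≥0∞) * ENNReal.ofReal (2 * ρ) < μ E →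
      (∀ x ∈ E, |x + s| ≤ M ∧ |P.eval (x + s)| ≤ ε) →
      ∀ k, |P.coeff k| ≤ ε * (1 + 2 * (1 + M) / ρ) ^ D := by
  intro D
  induction D with
  | zero =>
    intro P hP ε hε E hE h k
    have hne : E.Nonempty := by
      rw [Set.nonempty_iff_ne_empty]; rintro rfl; simp at hE
    obtain ⟨x, hx⟩ := hne
    have hP' := Polynomial.eq_C_of_natDegree_le_zero hP
    have h2 := (h x hx).2
    rw [hP'] at h2 ⊢
    simp only [eval_C] at h2
    rw [coeff_C]
    split_ifs
    · simpa using h2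
    · simpa using hε
  | succ D ih =>
    intro P hP ε hε E hE h k
    have hne : E.Nonempty := by
      rw [Set.nonempty_iff_ne_empty]; rintro rfl; simp at hE
    obtain ⟨x, hx⟩ := hne
    set t := x + s with ht
    set Q := P /ₘ (X - C t) with hQ
    have hPQ : P = C (P.eval t) + (X - C t) * Q := by
      have := modByMonic_add_div P (X - C t)
      rw [modByMonic_X_sub_C_eq_C_eval] at this
      exact this.symm
    have hQd : Q.natDegree ≤ D := by
      rw [hQ, natDegree_divByMonic _ (monic_X_sub_C t), natDegree_X_sub_C]; omega
    set E' := E \ Metric.closedBall x ρ with hE'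
    have hmE' : (D : ℝ≥0∞) * ENNReal.ofReal (2 * ρ) < μ E' := by
      by_contra hcon
      push Not at hcon
      have h1 : μ E ≤ μ E' + μ (Metric.closedBall x ρ) := by
        refine (measure_mono ?_).trans (measure_union_le _ _)
        intro y hy
        by_cases hyb : y ∈ Metric.closedBall x ρ
        · exact Or.inr hyb
        · exact Or.inl ⟨hy, hyb⟩
      have h2 : μ E ≤ (D : ℝ≥0∞) * ENNReal.ofReal (2 * ρ) + ENNReal.ofReal (2 * ρ) :=
        h1.trans (add_le_add hcon (hμ x))
      have h3 : ((D + 1 : ℕ) : ℝ≥0∞) * ENNReal.ofReal (2 * ρ)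
          = (D : ℝ≥0∞) * ENNReal.ofReal (2 * ρ) + ENNReal.ofReal (2 * ρ) := by
        push_cast; ring
      rw [h3] at hE
      exact absurd hE (not_lt.mpr h2)
    have hPt := (h x hx).2
    have hxM := (h x hx).1
    have hε' : 0 ≤ 2 * ε / ρ := by positivity
    have hQE : ∀ y ∈ E', |y + s| ≤ M ∧ |Q.eval (y + s)| ≤ 2 * ε / ρ := by
      intro y hy
      refine ⟨(h y hy.1).1, ?_⟩
      have hy2 := (h y hy.1).2
      have hd : ρ < |y - x| := by
        have := hy.2
        rw [Metric.mem_closedBall, Real.dist_eq] at this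
        linarith
      have he : P.eval (y + s) = P.eval t + (y - x) * Q.eval (y + s) := by
        conv_lhs => rw [hPQ]
        simp only [eval_add, eval_mul, eval_sub, eval_C, eval_X]
        rw [ht]; ring
      have h3 : |y - x| * |Q.eval (y + s)| ≤ 2 * ε := by
        rw [← abs_mul]
        have : (y - x) * Q.eval (y + s) = P.eval (y + s) - P.eval t := by rw [he]; ring
        rw [this]
        have := abs_sub (P.eval (y + s)) (P.eval t)
        linarith
      rw [le_div_iff₀ hρ]
      have := abs_nonneg (Q.eval (y + s))
      nlinarith
    have hc := ih Q hQd (2 * ε / ρ) hε' E' hmE' hQE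
    set L := 1 + 2 * (1 + M) / ρ with hL
    have hL1 : 1 ≤ L := by
      rw [hL]; have : 0 ≤ 2 * (1 + M) / ρ := by positivity
      linarith
    have hLD : 1 ≤ L ^ D := one_le_pow₀ hL1
    have hcoef : |P.coeff k| ≤ ε + (1 + M) * (2 * ε / ρ * L ^ D) := by
      have hb : 0 ≤ 2 * ε / ρ * L ^ D := by positivity
      cases k with
      | zero =>
        rw [hPQ]
        simp only [coeff_add, coeff_C_zero, mul_coeff_zero, coeff_sub, coeff_X_zero]
        have h1 := hc 0
        calc |eval t P + (0 - t) * Q.coeff 0| ≤ |eval t P| + |t| * |Q.coeff 0| := by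
              refine (abs_add_le _ _).trans ?_
              rw [abs_mul]; simp
          _ ≤ ε + M * (2 * ε / ρ * L ^ D) := by gcongr
          _ ≤ _ := by nlinarith
      | succ k =>
        rw [hPQ]
        simp only [coeff_add, coeff_C_succ, sub_mul, coeff_sub, coeff_X_mul, coeff_C_mul]
        have h1 := hc k
        have h2 := hc (k + 1)
        calc |0 + (Q.coeff k - t * Q.coeff (k + 1))| ≤ |Q.coeff k| + |t| * |Q.coeff (k + 1)| := by
              rw [zero_add, ← abs_mul]; exact abs_sub _ _
          _ ≤ 2 * ε / ρ * L ^ D + M * (2 * ε / ρ * L ^ D) := by gcongr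
          _ ≤ _ := by nlinarith
    calc |P.coeff k| ≤ ε + (1 + M) * (2 * ε / ρ * L ^ D) := hcoef
      _ ≤ ε * L ^ D + (1 + M) * (2 * ε / ρ * L ^ D) := by nlinarith
      _ = ε * L ^ (D + 1) := by rw [pow_succ, hL]; ring

lemma gauss_ball (x ρ : ℝ) :
    gaussianReal 0 1 (Metric.closedBall x ρ) ≤ ENNReal.ofReal (2 * ρ) := by
  rw [gaussianReal_apply _ one_ne_zero]
  calc ∫⁻ y in Metric.closedBall x ρ, gaussianPDF 0 1 y
      ≤ ∫⁻ y in Metric.closedBall x ρ, 1 := by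
        apply lintegral_mono
        intro y
        simp only [gaussianPDF]
        rw [ENNReal.ofReal_le_one, gaussianPDFReal]
        have h1 : (√(2 * π * (1 : ℝ≥0)))⁻¹ ≤ 1 := by
          apply inv_le_one_of_one_le₀
          rw [Real.one_le_sqrt]
          have := Real.pi_gt_three
          simp; linarith
        have h2 : rexp (-(y - 0) ^ 2 / (2 * (1 : ℝ≥0))) ≤ 1 := by
          rw [Real.exp_le_one_iff]
          have := sq_nonneg (y - 0)
          simp only [NNReal.coe_one]
          linarith
        exact mul_le_one₀ h1 (Real.exp_nonneg _) h2
    _ = ENNReal.ofReal (2 * ρ) := by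
        simp [Real.volume_closedBall]

lemma gauss_tail (r : ℝ) (hr : 0 < r) :
    gaussianReal 0 1 {x | r < |x|} ≤ ENNReal.ofReal (1 / r ^ 2) := by
  have h := meas_ge_le_variance_div_sq (μ := gaussianReal 0 1) (X := id)
    (memLp_id_gaussianReal 2) hr
  rw [variance_id_gaussianReal] at h
  refine (measure_mono ?_).trans (h.trans (by simp))
  intro x hx
  simp only [Set.mem_ofPred_eq, id, integral_id_gaussianReal, sub_zero] at hx ⊢
  exact hx.le

lemma fubini_markov {X Y : Type*} [MeasurableSpace X] [MeasurableSpace Y] (μ : Measure X)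
    (ν : Measure Y) [IsProbabilityMeasure μ] [IsProbabilityMeasure ν] (s : Set (X × Y))
    (hs : MeasurableSet s) (η : ℝ≥0∞) :
    (μ.prod ν) s ≤ η + ν {y | η < μ {x | (x, y) ∈ s}} := by
  rw [Measure.prod_apply_symm hs]
  have hm : Measurable fun y => μ ((fun x => (x, y)) ⁻¹' s) := measurable_measure_prodMk_right hs
  have hG : MeasurableSet {y | η < μ {x | (x, y) ∈ s}} := measurableSet_lt measurable_const hm
  calc ∫⁻ y, μ ((fun x => (x, y)) ⁻¹' s) ∂ν
      ≤ ∫⁻ y, (η + Set.indicator {y | η < μ {x | (x, y) ∈ s}} 1 y) ∂ν := by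
        apply lintegral_mono
        intro y
        by_cases hy : y ∈ {y | η < μ {x | (x, y) ∈ s}}
        · simp only [Set.indicator_of_mem hy, Pi.one_apply]
          exact prob_le_one.trans le_add_self
        · simp only [Set.indicator_of_notMem hy, add_zero]
          exact not_lt.mp hy
    _ = _ := by
        rw [lintegral_add_left measurable_const, lintegral_indicator_one hG]; simp

end helpers
section helpers2
open Polynomial

instance stdGaussianPi_prob (n : ℕ) : IsProbabilityMeasure (stdGaussianPi n) := by
  unfold stdGaussianPi; infer_instance

lemma uni_gauss (ρ r R : ℝ) (hρ : 0 < ρ) (hr : 0 < r) (hR : 0 ≤ R) (D : ℕ) (η : ℝ≥0∞)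
    (hη : (D : ℝ≥0∞) * ENNReal.ofReal (2 * ρ) + ENNReal.ofReal (1 / r ^ 2) ≤ η)
    (P : ℝ[X]) (hP : P.natDegree ≤ D) (s : ℝ) (hs : |s| ≤ R) (ε : ℝ) (hε : 0 ≤ ε)
    (h : η < gaussianReal 0 1 {x | |P.eval (x + s)| ≤ ε}) (k : ℕ) :
    |P.coeff k| ≤ ε * (1 + 2 * (1 + (r + R)) / ρ) ^ D := by
  refine uni_coeff (gaussianReal 0 1) ρ hρ (fun x => gauss_ball x ρ) (r + R) (by positivity) s D P
    hP ε hε ({x | |P.eval (x + s)| ≤ ε} \ {x | r < |x|}) ?_ ?_ k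
  · by_contra hcon
    push Not at hcon
    have h1 : gaussianReal 0 1 {x | |P.eval (x + s)| ≤ ε} ≤
        gaussianReal 0 1 ({x | |P.eval (x + s)| ≤ ε} \ {x | r < |x|})
          + gaussianReal 0 1 {x | r < |x|} := by
      refine (measure_mono ?_).trans (measure_union_le _ _)
      intro y hy
      by_cases hyb : y ∈ {x | r < |x|}
      · exact Or.inr hyb
      · exact Or.inl ⟨hy, hyb⟩
    have h2 := h1.trans (add_le_add hcon (gauss_tail r hr))
    exact absurd h (not_lt.mpr (h2.trans hη))
  · rintro x ⟨hx1, hx2⟩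
    refine ⟨?_, hx1⟩
    have hx3 : |x| ≤ r := not_lt.mp hx2
    exact (abs_add_le _ _).trans (add_le_add hx3 hs)

lemma ac (ρ r R : ℝ) (hρ : 0 < ρ) (hr : 0 < r) (hR : 0 ≤ R) (D : ℕ) (η : ℝ≥0∞)
    (hη : (D : ℝ≥0∞) * ENNReal.ofReal (2 * ρ) + ENNReal.ofReal (1 / r ^ 2) ≤ η) {J : Type*} :
    ∀ (m : ℕ) (s : Finset J) (c : J → ℝ) (e : J → Fin m → ℕ), (∀ j ∈ s, ∀ i, e j i ≤ D) →
      ∀ sh : Fin m → ℝ, (∀ i, |sh i| ≤ R) → ∀ ε : ℝ, 0 ≤ ε →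
      (m : ℝ≥0∞) * η < stdGaussianPi m {x | |∑ j ∈ s, c j * ∏ i, (x i + sh i) ^ (e j i)| ≤ ε} →
      ∀ k : Fin m → ℕ, |∑ j ∈ s with e j = k, c j|
        ≤ ε * ((1 + 2 * (1 + (r + R)) / ρ) ^ D) ^ m := by
  intro m
  induction m with
  | zero =>
    intro s c e he sh hsh ε hε h k
    have hne : {x : Fin 0 → ℝ | |∑ j ∈ s, c j * ∏ i, (x i + sh i) ^ (e j i)| ≤ ε}.Nonempty := by
      rw [Set.nonempty_iff_ne_empty]; intro h0; rw [h0] at h; simp at h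
    obtain ⟨x, hx⟩ := hne
    have hf : s.filter (fun j => e j = k) = s := by
      apply Finset.filter_true_of_mem
      intro j _; exact Subsingleton.elim _ _
    rw [hf]
    simpa using hx
  | succ m ih =>
    intro s c e he sh hsh ε hε h k
    set L := (1 + 2 * (1 + (r + R)) / ρ) ^ D with hL
    have hL0 : 0 ≤ L := by positivity
    set T : Set (ℝ × (Fin m → ℝ)) := {p | |∑ j ∈ s, (c j * ∏ i, (p.2 i + sh i.succ) ^ (e j i.succ))
      * (p.1 + sh 0) ^ (e j 0)| ≤ ε} with hT
    have hTm : MeasurableSet T := by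
      apply IsClosed.measurableSet
      apply isClosed_le _ continuous_const
      fun_prop
    have hpre : stdGaussianPi (m + 1) {x | |∑ j ∈ s, c j * ∏ i, (x i + sh i) ^ (e j i)| ≤ ε}
        = ((gaussianReal 0 1).prod (stdGaussianPi m)) T := by
      have hmp := measurePreserving_piFinSuccAbove (fun _ : Fin (m + 1) => gaussianReal 0 1) 0
      have := hmp.measure_preimage hTm.nullMeasurableSet
      unfold stdGaussianPi
      rw [← this]
      congr 1
      ext x
      simp only [hT, Set.mem_ofPred_eq, Set.mem_preimage, MeasurableEquiv.piFinSuccAbove_apply,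
        Fin.insertNthEquiv_symm_apply, Fin.removeNth_apply, Fin.zero_succAbove]
      have : ∀ j, c j * ∏ i, (x i + sh i) ^ (e j i) =
          (c j * ∏ i : Fin m, (x i.succ + sh i.succ) ^ (e j i.succ)) * (x 0 + sh 0) ^ (e j 0) := by
        intro j; rw [Fin.prod_univ_succ]; ring
      simp_rw [this]
    rw [hpre] at h
    have hfm := fubini_markov (gaussianReal 0 1) (stdGaussianPi m) T hTm η
    have hsub : {y : Fin m → ℝ | η < gaussianReal 0 1 {x | (x, y) ∈ T}} ⊆
        {y | |∑ j ∈ s.filter (fun j => e j 0 = k 0),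
          c j * ∏ i, (y i + sh i.succ) ^ (e j i.succ)| ≤ ε * L} := by
      intro y hy
      set P : ℝ[X] := ∑ j ∈ s, C (c j * ∏ i, (y i + sh i.succ) ^ (e j i.succ)) * X ^ (e j 0)
        with hP
      have hPd : P.natDegree ≤ D := by
        apply natDegree_sum_le_of_forall_le
        intro j hj
        exact (natDegree_C_mul_X_pow_le _ _).trans (he j hj 0)
      have hPe : ∀ x, P.eval (x + sh 0) = ∑ j ∈ s,
          (c j * ∏ i, (y i + sh i.succ) ^ (e j i.succ)) * (x + sh 0) ^ (e j 0) := by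
        intro x
        rw [hP, eval_finsetSum]
        simp only [eval_mul, eval_C, eval_pow, eval_X]
      have hu := uni_gauss ρ r R hρ hr hR D η hη P hPd (sh 0) (hsh 0) ε hε
        (by simp_rw [hPe]; exact hy) (k 0)
      have hco : P.coeff (k 0) = ∑ j ∈ s.filter (fun j => e j 0 = k 0),
          c j * ∏ i, (y i + sh i.succ) ^ (e j i.succ) := by
        rw [hP, finsetSum_coeff, Finset.sum_filter]
        apply Finset.sum_congr rfl
        intro j _
        rw [coeff_C_mul_X_pow]
        simp only [eq_comm]
      rw [hco] at hu
      exact hu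
    have hlt : (m : ℝ≥0∞) * η < stdGaussianPi m {y | |∑ j ∈ s.filter (fun j => e j 0 = k 0),
          c j * ∏ i, (y i + sh i.succ) ^ (e j i.succ)| ≤ ε * L} := by
      by_contra hcon
      push Not at hcon
      have h1 := hfm.trans (add_le_add le_rfl ((measure_mono hsub).trans hcon))
      refine absurd h (not_lt.mpr (h1.trans (le_of_eq ?_)))
      push_cast; ring
    have := ih (s.filter (fun j => e j 0 = k 0)) c (fun j i => e j i.succ)
      (fun j hj i => he j (Finset.mem_filter.mp hj).1 _) (fun i => sh i.succ) (fun i => hsh _)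
      (ε * L) (by positivity) hlt (fun i => k i.succ)
    rw [Finset.filter_filter] at this
    have hf : s.filter (fun j => e j = k) =
        s.filter (fun j => e j 0 = k 0 ∧ (fun i : Fin m => e j i.succ) = fun i => k i.succ) := by
      apply Finset.filter_congr
      intro j _
      constructor
      · rintro rfl; exact ⟨rfl, rfl⟩
      · rintro ⟨h0, h1⟩
        funext i
        refine Fin.cases h0 (fun i => congrFun h1 i) i
    rw [hf]
    refine this.trans (le_of_eq ?_)
    rw [pow_succ]; ring

/-- two-stage version -/
lemma ac2 (ρ r R : ℝ) (hρ : 0 < ρ) (hr : 0 < r) (hR : 0 ≤ R) (D d : ℕ) (η : ℝ≥0∞)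
    (hη : (D : ℝ≥0∞) * ENNReal.ofReal (2 * ρ) + ENNReal.ofReal (1 / r ^ 2) ≤ η)
    (hRr : r ^ d ≤ R) {J : Type*}
    (m : ℕ) (s : Finset J) (c : J → ℝ) (e f : J → Fin m → ℕ) (he : ∀ j ∈ s, ∀ i, e j i ≤ D)
    (hf : ∀ j ∈ s, ∀ i, f j i ≤ D) (ε : ℝ) (hε : 0 ≤ ε)
    (h : 2 * ((m : ℝ≥0∞) * η) < ((stdGaussianPi m).prod (stdGaussianPi m))
      {p | |∑ j ∈ s, c j * ((∏ i, (p.1 i + p.2 i ^ d) ^ (e j i)) * ∏ i, p.2 i ^ (f j i))| ≤ ε ∧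
        ∀ i, |p.2 i| ≤ r})
    (k l : Fin m → ℕ) :
    |∑ j ∈ s with e j = k ∧ f j = l, c j|
        ≤ ε * ((1 + 2 * (1 + (r + R)) / ρ) ^ D) ^ (2 * m) := by
  set T : Set ((Fin m → ℝ) × (Fin m → ℝ)) :=
    {p | |∑ j ∈ s, c j * ((∏ i, (p.1 i + p.2 i ^ d) ^ (e j i)) * ∏ i, p.2 i ^ (f j i))| ≤ ε ∧
        ∀ i, |p.2 i| ≤ r} with hT
  have hTm : MeasurableSet T := by
    apply IsClosed.measurableSet
    have h1 : IsClosed {p : (Fin m → ℝ) × (Fin m → ℝ) |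
        |∑ j ∈ s, c j * ((∏ i, (p.1 i + p.2 i ^ d) ^ (e j i)) * ∏ i, p.2 i ^ (f j i))| ≤ ε} :=
      isClosed_le (by fun_prop) continuous_const
    refine IsClosed.inter h1 ?_
    have : {p : (Fin m → ℝ) × (Fin m → ℝ) | ∀ i, |p.2 i| ≤ r} = ⋂ i, {p | |p.2 i| ≤ r} := by
      ext p; simp
    change IsClosed {p : (Fin m → ℝ) × (Fin m → ℝ) | ∀ i, |p.2 i| ≤ r}
    rw [this]
    exact isClosed_iInter fun i => isClosed_le (by fun_prop) continuous_const
  have hfm := fubini_markov (stdGaussianPi m) (stdGaussianPi m) T hTm (m * η)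
  set K := (1 + 2 * (1 + (r + R)) / ρ) ^ D with hK
  have hK0 : 0 ≤ K := by positivity
  have hsub : {y : Fin m → ℝ | m * η < stdGaussianPi m {x | (x, y) ∈ T}} ⊆
      {y | |∑ j ∈ s.filter (fun j => e j = k), c j * ∏ i, (y i + 0) ^ (f j i)| ≤ ε * K ^ m} := by
    intro y hy
    have hy' : m * η < stdGaussianPi m {x | (x, y) ∈ T} := hy
    have hyb : ∀ i, |y i| ≤ r := by
      have hne : {x | (x, y) ∈ T}.Nonempty := by
        rw [Set.nonempty_iff_ne_empty]; intro h0; rw [h0] at hy'; simp at hy'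
      obtain ⟨x, hx⟩ := hne
      exact hx.2
    have := ac ρ r R hρ hr hR D η hη m s (fun j => c j * ∏ i, y i ^ (f j i)) e he
      (fun i => y i ^ d) (fun i => by
        rw [abs_pow]
        exact (pow_le_pow_left₀ (abs_nonneg _) (hyb i) d).trans hRr) ε hε
      (by
        refine hy'.trans_le (measure_mono ?_)
        intro x hx
        have := hx.1
        simp only [Set.mem_ofPred_eq] at this ⊢
        have hh : ∀ j, (c j * ∏ i, y i ^ (f j i)) * ∏ i, (x i + y i ^ d) ^ (e j i) =
          c j * ((∏ i, (x i + y i ^ d) ^ (e j i)) * ∏ i, y i ^ (f j i)) := fun j => by ring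
        simp_rw [hh]
        exact this) k
    simpa using this
  have hlt : m * η < stdGaussianPi m
      {y | |∑ j ∈ s.filter (fun j => e j = k), c j * ∏ i, (y i + 0) ^ (f j i)| ≤ ε * K ^ m} := by
    by_contra hcon
    push Not at hcon
    have h1 := hfm.trans (add_le_add le_rfl ((measure_mono hsub).trans hcon))
    refine absurd h (not_lt.mpr (h1.trans (le_of_eq ?_)))
    ring
  have := ac ρ r R hρ hr hR D η hη m (s.filter (fun j => e j = k)) c f
    (fun j hj => hf j (Finset.mem_filter.mp hj).1) (fun _ => 0) (fun i => by simpa using hR)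
    (ε * K ^ m) (by positivity) hlt l
  rw [Finset.filter_filter] at this
  refine this.trans (le_of_eq ?_)
  rw [mul_comm 2 m, pow_mul, ← hK]; ring

end helpers2
section combi

/-- exponents of the fresh variables -/
def expE {n : ℕ} (a : Fin n → Bool) (S : Multiset (Fin n ⊕ Fin n)) (i : Fin n) : ℕ :=
  if a i then S.count (Sum.inl i) else 0

/-- exponents of the variables `g` -/
def expF {n : ℕ} (d : ℕ) (a : Fin n → Bool) (S : Multiset (Fin n ⊕ Fin n)) (i : Fin n) : ℕ :=
  (if a i then 0 else d * S.count (Sum.inl i)) + S.count (Sum.inr i)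

lemma fiber_aux {n d : ℕ} (hd : 1 ≤ d) (a : Fin n → Bool) (S S' : Multiset (Fin n ⊕ Fin n))
    (hS : Multiset.card S ≤ d) (hE : expE a S = expE a S')
    (hF : expF d a S = expF d a S') (i : Fin n) (hi : S.count (Sum.inl i) < S'.count (Sum.inl i)) :
    a i = false ∧ S = Multiset.replicate d (Sum.inr i) ∧ S' = {Sum.inl i} := by
  have hai : a i = false := by
    by_contra h
    have h' : a i = true := by simpa using h
    have := congrFun hE i
    simp only [expE, h', if_true] at this
    omega
  have hFi := congrFun hF i
  simp only [expF, hai, Bool.false_eq_true, if_false] at hFi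
  have ht : d ≤ S.count (Sum.inr i) := by nlinarith
  have hSr : S = Multiset.replicate d (Sum.inr i) := by
    have h1 := Multiset.le_count_iff_replicate_le.mp ht
    exact (Multiset.eq_of_le_of_card_le h1 (by simpa using hS)).symm
  refine ⟨hai, hSr, ?_⟩
  have hl : ∀ j, S.count (Sum.inl j) = 0 := by
    intro j; rw [hSr, Multiset.count_replicate]; simp
  have hr : ∀ j, S.count (Sum.inr j) = if i = j then d else 0 := by
    intro j; rw [hSr, Multiset.count_replicate]; simp
  rw [hl i, hr i] at hFi
  simp only [if_true, mul_zero, zero_add] at hFi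
  have h1 : S'.count (Sum.inl i) = 1 := by
    have : 1 ≤ S'.count (Sum.inl i) := by omega
    nlinarith
  have h2 : S'.count (Sum.inr i) = 0 := by rw [h1] at hFi; omega
  ext x
  rcases x with j | j
  · by_cases hj : j = i
    · subst hj; rw [h1]; simp
    · rw [Multiset.count_singleton, if_neg (by simpa using hj)]
      cases haj : a j
      · have := congrFun hF j
        simp only [expF, haj, Bool.false_eq_true, if_false, hl, hr] at this
        rw [if_neg (fun h => hj h.symm)] at this
        have h3 : d * S'.count (Sum.inl j) = 0 := by omega
        rcases Nat.mul_eq_zero.mp h3 with h | h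
        · omega
        · exact h
      · have := congrFun hE j
        simp only [expE, haj, if_true, hl] at this
        exact this.symm
  · rw [Multiset.count_singleton, if_neg (by simp)]
    by_cases hj : j = i
    · subst hj; exact h2
    · have := congrFun hF j
      simp only [expF, hl, hr] at this
      have hij : ¬ i = j := fun h => hj h.symm
      simp only [hij, if_false] at this
      split_ifs at this <;> omega

lemma fiber {n d : ℕ} (hd : 1 ≤ d) (a : Fin n → Bool) (S S' : Multiset (Fin n ⊕ Fin n))
    (hS : Multiset.card S ≤ d) (hS' : Multiset.card S' ≤ d) (hE : expE a S = expE a S')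
    (hF : expF d a S = expF d a S') (hne : S ≠ S') :
    ∃ i, a i = false ∧ ((S = {Sum.inl i} ∧ S' = Multiset.replicate d (Sum.inr i)) ∨
      (S = Multiset.replicate d (Sum.inr i) ∧ S' = {Sum.inl i})) := by
  by_cases h : ∃ i, S.count (Sum.inl i) ≠ S'.count (Sum.inl i)
  · obtain ⟨i, hi⟩ := h
    rcases lt_or_gt_of_ne hi with h | h
    · obtain ⟨h1, h2, h3⟩ := fiber_aux hd a S S' hS hE hF i h
      exact ⟨i, h1, Or.inr ⟨h2, h3⟩⟩
    · obtain ⟨h1, h2, h3⟩ := fiber_aux hd a S' S hS' hE.symm hF.symm i h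
      exact ⟨i, h1, Or.inl ⟨h3, h2⟩⟩
  · push Not at h
    exfalso; apply hne
    ext x
    rcases x with j | j
    · exact h j
    · have := congrFun hF j
      simp only [expF, h j] at this
      omega

lemma good_coef {n d : ℕ} (hd : 1 ≤ d) (a : Fin n → Bool) (c : Multiset (Fin n ⊕ Fin n) →₀ ℝ)
    (hc : ∀ S ∈ c.support, Multiset.card S ≤ d) (τ : ℝ)
    (H : ∀ k l : Fin n → ℕ, |∑ S ∈ c.support with expE a S = k ∧ expF d a S = l, c S| ≤ τ) :
    (∀ S, τ < |c S| → ∃ i, a i = false ∧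
      (S = {Sum.inl i} ∨ S = Multiset.replicate d (Sum.inr i))) ∧
    (∀ i, a i = false → |c {Sum.inl i} + c (Multiset.replicate d (Sum.inr i))| ≤ τ) := by
  have hτ : 0 ≤ τ := (abs_nonneg _).trans (H 0 0)
  constructor
  · intro S hS
    by_contra hcon
    have hSs : S ∈ c.support := by
      rw [Finsupp.mem_support_iff]; intro h0; rw [h0] at hS; simp at hS; linarith
    have hf : c.support.filter (fun T => expE a T = expE a S ∧ expF d a T = expF d a S) = {S} := by
      ext T
      simp only [Finset.mem_filter, Finset.mem_singleton]
      constructor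
      · rintro ⟨hT, h1, h2⟩
        by_contra hne
        obtain ⟨i, hi, h | h⟩ := fiber hd a T S (hc T hT) (hc S hSs) h1 h2 hne
        · exact hcon ⟨i, hi, Or.inr h.2⟩
        · exact hcon ⟨i, hi, Or.inl h.2⟩
      · rintro rfl; exact ⟨hSs, rfl, rfl⟩
    have := H (expE a S) (expF d a S)
    rw [hf, Finset.sum_singleton] at this
    linarith
  · intro i hi
    have hne : ({Sum.inl i} : Multiset (Fin n ⊕ Fin n)) ≠ Multiset.replicate d (Sum.inr i) := by
      intro h
      have h1 : (Sum.inl i : Fin n ⊕ Fin n) ∈ Multiset.replicate d (Sum.inr i) := by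
        rw [← h]; simp
      simpa using Multiset.eq_of_mem_replicate h1
    have hH := H (expE a {Sum.inl i}) (expF d a {Sum.inl i})
    rw [← Finset.sum_pair (f := fun S => c S) hne]
    convert hH using 2
    symm
    apply Finset.sum_subset
    · intro T hT
      simp only [Finset.mem_filter] at hT
      obtain ⟨hT, h1, h2⟩ := hT
      simp only [Finset.mem_insert, Finset.mem_singleton]
      by_cases hTe : T = {Sum.inl i}
      · exact Or.inl hTe
      · right
        obtain ⟨j, hj, h | h⟩ := fiber hd a T {Sum.inl i} (hc T hT) (by simpa using hd) h1 h2 hTe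
        · exfalso
          have h1 : (Sum.inl i : Fin n ⊕ Fin n) ∈ Multiset.replicate d (Sum.inr j) := by
            rw [← h.2]; simp
          simpa using Multiset.eq_of_mem_replicate h1
        · have h3 := h.2
          rw [Multiset.singleton_inj] at h3
          rw [h.1]
          have : i = j := by simpa using h3
          rw [this]
    · intro T hT hT2
      by_contra h0
      apply hT2
      simp only [Finset.mem_filter, Finsupp.mem_support_iff]
      refine ⟨h0, ?_⟩
      simp only [Finset.mem_insert, Finset.mem_singleton] at hT
      rcases hT with rfl | rfl
      · exact ⟨rfl, rfl⟩
      · constructor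
        · funext j
          simp only [expE, Multiset.count_replicate, Multiset.count_singleton]
          by_cases hj : j = i
          · subst hj; simp [hi]
          · simp [hj]
        · funext j
          simp only [expF, Multiset.count_replicate, Multiset.count_singleton]
          by_cases hj : j = i
          · subst hj; simp [hi]
          · have : ¬ i = j := fun h => hj h.symm
            simp [hj, this]

lemma sum_low {n : ℕ} {κ : Type*} (c : κ →₀ ℝ) (p : κ → Prop) [DecidablePred p]
    (φ : Fin n → κ) (hφ : Function.Injective φ) (hp : ∀ i, p (φ i)) :
    ∑ i, |c (φ i)| ≤ ∑ S ∈ c.support, if p S then |c S| else 0 := by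
  classical
  rw [← Finset.sum_filter]
  rw [← Finset.sum_image (s := Finset.univ) (g := φ) (f := fun S => |c S|) (hφ.injOn)]
  rw [← Finset.sum_filter_of_ne (p := fun S => c S ≠ 0) (by intro x _ h h0; simp [h0] at h)]
  apply Finset.sum_le_sum_of_subset_of_nonneg
  · intro S hS
    simp only [Finset.mem_filter, Finset.mem_image, Finset.mem_univ, true_and,
      Finsupp.mem_support_iff] at hS ⊢
    obtain ⟨⟨i, rfl⟩, h⟩ := hS
    exact ⟨h, hp i⟩
  · intros; positivity

lemma sum_high {n : ℕ} {κ : Type*} (c : κ →₀ ℝ) (p : κ → Prop) [DecidablePred p]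
    (φ : Fin n → κ) (hφ : Function.Injective φ) (τ : ℝ) (hτ : 0 ≤ τ)
    (hp : ∀ S, p S → τ < |c S| → ∃ i, S = φ i) :
    (∑ S ∈ c.support, if p S then |c S| else 0) ≤ ∑ i, |c (φ i)| + c.support.card * τ := by
  classical
  calc (∑ S ∈ c.support, if p S then |c S| else 0)
      ≤ ∑ S ∈ c.support, ((if S ∈ Finset.univ.image φ then |c S| else 0) + τ) := by
        apply Finset.sum_le_sum
        intro S _
        have h0 := abs_nonneg (c S)
        by_cases hpS : p S
        · rw [if_pos hpS]
          by_cases ht : τ < |c S|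
          · obtain ⟨i, hi⟩ := hp S hpS ht
            rw [if_pos (by rw [hi]; simp)]; linarith
          · push Not at ht
            split_ifs <;> linarith
        · rw [if_neg hpS]; split_ifs <;> linarith
    _ ≤ _ := by
        rw [Finset.sum_add_distrib, Finset.sum_const, nsmul_eq_mul, ← Finset.sum_filter]
        gcongr
        rw [← Finset.sum_image (s := Finset.univ) (g := φ) (f := fun S => |c S|) (hφ.injOn)]
        apply Finset.sum_le_sum_of_subset_of_nonneg
        · intro S hS; exact (Finset.mem_filter.mp hS).2
        · intros; positivity

lemma weights {n d : ℕ} (hd : 1 ≤ d) (a : Fin n → Bool) (c : Multiset (Fin n ⊕ Fin n) →₀ ℝ)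
    (τ : ℝ) (hτ : 0 ≤ τ)
    (H1 : ∀ S, τ < |c S| → ∃ i, a i = false ∧
      (S = {Sum.inl i} ∨ S = Multiset.replicate d (Sum.inr i)))
    (H2 : ∀ i, a i = false → |c {Sum.inl i} + c (Multiset.replicate d (Sum.inr i))| ≤ τ)
    (hW : 0 < weight c) (hN : 100 * ((c.support.card + n) * τ) ≤ weight c)
    (hC : 100 * ((Nat.choose (n + d) d : ℝ) * τ) ≤ weight c) :
    τ < 0.5 * weightLeft c / (Nat.choose (n + d) d : ℝ) ∧
    τ < 1 * weightRight c / (Nat.choose (n + d) d : ℝ) ∧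
    0.5 * weightLeft c / (Nat.choose (n + d) d : ℝ)
      ≤ 1 * weightRight c / (Nat.choose (n + d) d : ℝ) - τ := by
  have hφ1 : Function.Injective (fun i : Fin n => ({Sum.inl i} : Multiset (Fin n ⊕ Fin n))) := by
    intro i j h
    simpa using h
  have hφ2 : Function.Injective
      (fun i : Fin n => (Multiset.replicate d (Sum.inr i) : Multiset (Fin n ⊕ Fin n))) := by
    intro i j h
    have h1 : (Sum.inr i : Fin n ⊕ Fin n) ∈ Multiset.replicate d (Sum.inr j) := by
      have h' : Multiset.replicate d (Sum.inr i : Fin n ⊕ Fin n)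
        = Multiset.replicate d (Sum.inr j) := h
      rw [← h', Multiset.mem_replicate]; exact ⟨by omega, rfl⟩
    simpa using Multiset.eq_of_mem_replicate h1
  have hr0 : ∀ i : Fin n, (Multiset.replicate d (Sum.inr i : Fin n ⊕ Fin n)) ≠ 0 := by
    intro i h
    have := congrArg Multiset.card h
    simp at this; omega
  have hw1l : ∑ i, |c {Sum.inl i}| ≤ weightLeft c := by
    unfold weightLeft
    exact sum_low c _ _ hφ1 (by intro i; simp)
  have hw2l : ∑ i, |c (Multiset.replicate d (Sum.inr i))| ≤ weightRight c := by
    unfold weightRight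
    refine sum_low c _ _ hφ2 ?_
    intro i
    refine ⟨hr0 i, fun x hx => ?_⟩
    rw [Multiset.eq_of_mem_replicate hx]; rfl
  have hw1u : weightLeft c ≤ ∑ i, |c {Sum.inl i}| + c.support.card * τ := by
    unfold weightLeft
    refine sum_high c _ _ hφ1 τ hτ ?_
    rintro S ⟨hS0, hS⟩ ht
    obtain ⟨i, _, h | h⟩ := H1 S ht
    · exact ⟨i, h⟩
    · exfalso
      have := hS (Sum.inr i) (by rw [h, Multiset.mem_replicate]; exact ⟨by omega, rfl⟩)
      simp at this
  have hw2u : weightRight c ≤ ∑ i, |c (Multiset.replicate d (Sum.inr i))|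
      + c.support.card * τ := by
    unfold weightRight
    refine sum_high c _ _ hφ2 τ hτ ?_
    rintro S ⟨hS0, hS⟩ ht
    obtain ⟨i, _, h | h⟩ := H1 S ht
    · exfalso
      have := hS (Sum.inl i) (by rw [h]; simp)
      simp at this
    · exact ⟨i, h⟩
  have hWu : weight c ≤ weightLeft c + weightRight c + c.support.card * τ := by
    unfold weight weightLeft weightRight
    rw [← nsmul_eq_mul, ← Finset.sum_const, ← Finset.sum_add_distrib, ← Finset.sum_add_distrib]
    apply Finset.sum_le_sum
    intro S _
    have h0 := abs_nonneg (c S)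
    by_cases ht : τ < |c S|
    · obtain ⟨i, _, h | h⟩ := H1 S ht
      · have hp : S ≠ 0 ∧ ∀ x ∈ S, x.isLeft = true := by rw [h]; simp
        rw [if_neg hp.1, if_pos hp]
        split_ifs <;> linarith
      · have hp : S ≠ 0 ∧ ∀ x ∈ S, x.isRight = true := by
          rw [h]
          refine ⟨hr0 i, fun x hx => ?_⟩
          rw [Multiset.eq_of_mem_replicate hx]; rfl
        rw [if_neg hp.1, if_pos hp]
        split_ifs <;> linarith
    · push Not at ht
      split_ifs <;> linarith
  have huv : ∀ i, |c {Sum.inl i}| ≤ |c (Multiset.replicate d (Sum.inr i))| + τ ∧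
      |c (Multiset.replicate d (Sum.inr i))| ≤ |c {Sum.inl i}| + τ := by
    intro i
    cases hai : a i
    · have h2 := H2 i hai
      have h3 := abs_abs_sub_abs_le (c {Sum.inl i}) (-c (Multiset.replicate d (Sum.inr i)))
      rw [sub_neg_eq_add, abs_neg] at h3
      have h4 := abs_le.mp (h3.trans h2)
      constructor <;> linarith [h4.1, h4.2]
    · have h1 : |c {Sum.inl i}| ≤ τ := by
        by_contra hcon
        obtain ⟨j, hj, h | h⟩ := H1 _ (not_le.mp hcon)
        · have := hφ1 h
          rw [this] at hai; simp [hj] at hai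
        · have h1 : (Sum.inl i : Fin n ⊕ Fin n) ∈ Multiset.replicate d (Sum.inr j) := by
            rw [← h]; simp
          simpa using Multiset.eq_of_mem_replicate h1
      have h2 : |c (Multiset.replicate d (Sum.inr i))| ≤ τ := by
        by_contra hcon
        obtain ⟨j, hj, h | h⟩ := H1 _ (not_le.mp hcon)
        · have h1 : (Sum.inl j : Fin n ⊕ Fin n) ∈ Multiset.replicate d (Sum.inr i) := by
            rw [h]; simp
          simpa using Multiset.eq_of_mem_replicate h1
        · have := hφ2 h
          rw [this] at hai; simp [hj] at hai
      have := abs_nonneg (c {Sum.inl i})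
      have := abs_nonneg (c (Multiset.replicate d (Sum.inr i)))
      constructor <;> linarith
  have hu : ∑ i, |c {Sum.inl i}| ≤ ∑ i, |c (Multiset.replicate d (Sum.inr i))| + n * τ := by
    calc _ ≤ ∑ i : Fin n, (|c (Multiset.replicate d (Sum.inr i))| + τ) :=
          Finset.sum_le_sum fun i _ => (huv i).1
      _ = _ := by simp [Finset.sum_add_distrib]
  have hv : ∑ i, |c (Multiset.replicate d (Sum.inr i))| ≤ ∑ i, |c {Sum.inl i}| + n * τ := by
    calc _ ≤ ∑ i : Fin n, (|c {Sum.inl i}| + τ) :=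
          Finset.sum_le_sum fun i _ => (huv i).2
      _ = _ := by simp [Finset.sum_add_distrib]
  have hCpos : (0 : ℝ) < Nat.choose (n + d) d := by
    exact_mod_cast Nat.choose_pos (by omega)
  have hnτ : 0 ≤ (n : ℝ) * τ := by positivity
  have hcτ : 0 ≤ (c.support.card : ℝ) * τ := by positivity
  rw [add_mul] at hN
  refine ⟨?_, ?_, ?_⟩
  · rw [lt_div_iff₀ hCpos]; linarith
  · rw [lt_div_iff₀ hCpos]; linarith
  · rw [le_sub_iff_add_le, div_add' _ _ _ hCpos.ne']
    gcongr
    linarith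

lemma supp_card {n d : ℕ} (c : Multiset (Fin n ⊕ Fin n) →₀ ℝ)
    (hc : ∀ S ∈ c.support, Multiset.card S ≤ d) : c.support.card ≤ (d + 1) ^ (2 * n) := by
  have h : c.support.card ≤ (Finset.univ : Finset (Fin n ⊕ Fin n → Fin (d + 1))).card := by
    refine Finset.card_le_card_of_injOn
      (fun S x => Fin.ofNat (d + 1) (S.count x)) (by intro S _; simp) ?_
    intro S hS T hT h
    ext x
    have := congrArg Fin.val (congrFun h x)
    simp only [Fin.val_ofNat] at this
    have h1 := (Multiset.count_le_card x S).trans (hc S hS)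
    have h2 := (Multiset.count_le_card x T).trans (hc T hT)
    rwa [Nat.mod_eq_of_lt (by omega), Nat.mod_eq_of_lt (by omega)] at this
  refine h.trans (le_of_eq ?_)
  simp [two_mul]

end combi
section numeric

lemma numeric (d D : ℕ) (hd : 1 ≤ d) (hD : 1 ≤ D) : ∃ N : ℕ, ∀ n ≥ N, 3 ≤ n ∧
    7 * Real.log n < 2 * n ∧ 3 ≤ Real.exp 1 * n ∧ 1 ≤ Real.log n ∧
    ∀ X : ℝ, 0 ≤ X → X ≤ 2 * (n : ℝ) ^ n →
    100 * (X * ((d * ((n : ℝ) + (n : ℝ) ^ d + 1) ^ d * ((2 : ℝ) ^ (n ^ 2))⁻¹) *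
      ((1 + 2 * (1 + ((n : ℝ) + (n : ℝ) ^ d)) / (1 / (2 * D * (n : ℝ) ^ 2))) ^ D) ^ (2 * n))) ≤ 1
    := by
  set B := 2 + (d + 1) * d + 2 * ((d + 4) * D) + 1 with hB
  have h1 : ∀ᶠ n : ℕ in Filter.atTop, (n : ℝ) ^ B ≤ 2 ^ n := by
    have := (isLittleO_pow_const_const_pow_of_one_lt (R := ℝ) B (r := 2) (by norm_num)).bound
      (c := 1) one_pos
    filter_upwards [this] with n hn
    simpa using hn
  have h2 : ∀ᶠ n : ℕ in Filter.atTop, 7 * Real.log n < 2 * n := by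
    have := (Real.isLittleO_log_id_atTop.comp_tendsto tendsto_natCast_atTop_atTop).bound
      (c := 1 / 7) (by norm_num)
    filter_upwards [this, Filter.eventually_gt_atTop 0] with n hn h0
    have h0' : (0 : ℝ) < n := by exact_mod_cast h0
    simp only [Function.comp, id, Real.norm_eq_abs, abs_of_pos h0'] at hn
    have := le_abs_self (Real.log n)
    linarith
  obtain ⟨N, hN⟩ := Filter.eventually_atTop.mp (h1.and h2)
  refine ⟨max N (max 200 (max (d + 1) (4 * D + 1))), fun n hn => ?_⟩
  simp only [ge_iff_le, max_le_iff] at hn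
  obtain ⟨hnN, hn200, hnd, hnD⟩ := hn
  obtain ⟨hB2, hlog⟩ := hN n hnN
  have hr200 : (200 : ℝ) ≤ n := by exact_mod_cast hn200
  have hrd : (d : ℝ) ≤ n := by exact_mod_cast (by omega : d ≤ n)
  have hrD : 4 * (D : ℝ) + 1 ≤ n := by exact_mod_cast hnD
  have hn1 : (1 : ℝ) ≤ n := by linarith
  have hexp : Real.exp 1 ≤ 3 := by have := Real.exp_one_lt_d9; linarith
  refine ⟨by omega, hlog, ?_, ?_, ?_⟩
  · have := Real.add_one_le_exp 1; nlinarith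
  · rw [Real.le_log_iff_exp_le (by linarith)]; linarith
  intro X hX0 hX
  have hnn : (n : ℝ) ≤ (n : ℝ) ^ d := le_self_pow₀ hn1 (by omega)
  have hnd1 : 1 ≤ (n : ℝ) ^ d := one_le_pow₀ hn1
  have hM : (n : ℝ) + (n : ℝ) ^ d + 1 ≤ (n : ℝ) ^ (d + 1) := by
    rw [pow_succ]; nlinarith
  have hL : 1 + 2 * (1 + ((n : ℝ) + (n : ℝ) ^ d)) / (1 / (2 * D * (n : ℝ) ^ 2))
      ≤ (n : ℝ) ^ (d + 4) := by
    have e : 1 + 2 * (1 + ((n : ℝ) + (n : ℝ) ^ d)) / (1 / (2 * D * (n : ℝ) ^ 2))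
      = 1 + (n + (n : ℝ) ^ d + 1) * (4 * D * (n : ℝ) ^ 2) := by
        rw [div_div_eq_mul_div]; ring
    rw [e]
    have hone : 1 ≤ (n : ℝ) ^ (d + 3) := one_le_pow₀ hn1
    calc 1 + (n + (n : ℝ) ^ d + 1) * (4 * D * (n : ℝ) ^ 2)
        ≤ (n : ℝ) ^ (d + 3) + (n : ℝ) ^ (d + 1) * (4 * D * (n : ℝ) ^ 2) := by gcongr
      _ = (n : ℝ) ^ (d + 3) * (4 * D + 1) := by ring
      _ ≤ (n : ℝ) ^ (d + 3) * n := by gcongr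
      _ = _ := by ring
  have hLn : 0 ≤ 1 + 2 * (1 + ((n : ℝ) + (n : ℝ) ^ d)) / (1 / (2 * D * (n : ℝ) ^ 2)) := by positivity
  have hmain : 100 * (X * ((d * ((n : ℝ) + (n : ℝ) ^ d + 1) ^ d) *
      ((1 + 2 * (1 + ((n : ℝ) + (n : ℝ) ^ d)) / (1 / (2 * D * (n : ℝ) ^ 2))) ^ D) ^ (2 * n)))
      ≤ 2 ^ (n ^ 2) := by
    calc 100 * (X * ((d * ((n : ℝ) + (n : ℝ) ^ d + 1) ^ d) *
      ((1 + 2 * (1 + ((n : ℝ) + (n : ℝ) ^ d)) / (1 / (2 * D * (n : ℝ) ^ 2))) ^ D) ^ (2 * n)))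
        ≤ 100 * ((2 * (n : ℝ) ^ n) * ((n * ((n : ℝ) ^ (d + 1)) ^ d) *
      (((n : ℝ) ^ (d + 4)) ^ D) ^ (2 * n))) := by gcongr
      _ = 200 * ((n : ℝ) ^ n * (n * ((n : ℝ) ^ (d + 1)) ^ d) *
      (((n : ℝ) ^ (d + 4)) ^ D) ^ (2 * n)) := by ring
      _ ≤ n * ((n : ℝ) ^ n * (n * ((n : ℝ) ^ (d + 1)) ^ d) *
      (((n : ℝ) ^ (d + 4)) ^ D) ^ (2 * n)) := by gcongr
      _ = (n : ℝ) ^ (2 + (d + 1) * d + 2 * ((d + 4) * D) * n + n) := by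
        simp only [← pow_mul]; ring
      _ ≤ (n : ℝ) ^ (B * n) := by
        apply pow_le_pow_right₀ hn1
        rw [hB]
        have : 2 + (d + 1) * d ≤ (2 + (d + 1) * d) * n := Nat.le_mul_of_pos_right _ (by omega)
        nlinarith
      _ = ((n : ℝ) ^ B) ^ n := by rw [pow_mul]
      _ ≤ ((2 : ℝ) ^ n) ^ n := by gcongr
      _ = 2 ^ (n ^ 2) := by rw [← pow_mul, sq]
  have hpos : (0 : ℝ) < 2 ^ (n ^ 2) := by positivity
  calc _ = (100 * (X * ((d * ((n : ℝ) + (n : ℝ) ^ d + 1) ^ d) *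
      ((1 + 2 * (1 + ((n : ℝ) + (n : ℝ) ^ d)) / (1 / (2 * D * (n : ℝ) ^ 2))) ^ D) ^ (2 * n))))
        * ((2 : ℝ) ^ (n ^ 2))⁻¹ := by ring
    _ ≤ 2 ^ (n ^ 2) * ((2 : ℝ) ^ (n ^ 2))⁻¹ := by gcongr
    _ = 1 := mul_inv_cancel₀ hpos.ne'

end numeric

section eval

lemma polyEval_eq {n : ℕ} (c : Multiset (Fin n ⊕ Fin n) →₀ ℝ) (x : Fin n ⊕ Fin n → ℝ) :
    polyEval c x = ∑ S ∈ c.support, c S * ∏ v, x v ^ (S.count v) := by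
  unfold polyEval
  apply Finset.sum_congr rfl
  intro S _
  rw [Finset.prod_multiset_map_count]
  congr 1
  apply Finset.prod_subset (Finset.subset_univ _)
  intro v _ hv
  rw [Multiset.mem_toFinset] at hv
  rw [Multiset.count_eq_zero_of_notMem hv, pow_zero]

/-- unperturbed query point -/
noncomputable def basePoint (d n : ℕ) (a : Fin n → Bool) (h g : Fin n → ℝ) : Fin n ⊕ Fin n → ℝ :=
  Sum.elim (fun i => (if a i then h i else 0) + g i ^ d) g

lemma polyEval_base {n : ℕ} (d : ℕ) (c : Multiset (Fin n ⊕ Fin n) →₀ ℝ) (a : Fin n → Bool)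
    (h g : Fin n → ℝ) :
    polyEval c (basePoint d n a h g) = ∑ S ∈ c.support,
      c S * ((∏ i, (h i + g i ^ d) ^ (expE a S i)) * ∏ i, g i ^ (expF d a S i)) := by
  rw [polyEval_eq]
  apply Finset.sum_congr rfl
  intro S _
  congr 1
  rw [Fintype.prod_sum_type, ← Finset.prod_mul_distrib, ← Finset.prod_mul_distrib]
  apply Finset.prod_congr rfl
  intro i _
  simp only [basePoint, Sum.elim_inl, Sum.elim_inr, expE, expF]
  split_ifs
  · simp
  · rw [zero_add, pow_zero, one_mul, pow_add, pow_mul]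

lemma prod_dev {κ : Type*} (y y' : κ → ℝ) (M δ : ℝ) (hM : 1 ≤ M) (hδ : 0 ≤ δ)
    (hy : ∀ v, |y v| ≤ M) (hy' : ∀ v, |y' v| ≤ M) (hd : ∀ v, |y v - y' v| ≤ δ)
    (S : Multiset κ) :
    |(S.map y).prod - (S.map y').prod| ≤ Multiset.card S * M ^ (Multiset.card S) * δ ∧
    |(S.map y').prod| ≤ M ^ (Multiset.card S) := by
  induction S using Multiset.induction_on with
  | empty => simp
  | cons v S ih =>
    obtain ⟨h1, h2⟩ := ih
    simp only [Multiset.map_cons, Multiset.prod_cons, Multiset.card_cons]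
    set p := (S.map y).prod
    set p' := (S.map y').prod
    set k := Multiset.card S
    have hMk : 0 ≤ M ^ k := by positivity
    constructor
    · calc |y v * p - y' v * p'| = |y v * (p - p') + (y v - y' v) * p'| := by ring_nf
        _ ≤ |y v| * |p - p'| + |y v - y' v| * |p'| := by
            rw [← abs_mul, ← abs_mul]; exact abs_add_le _ _
        _ ≤ M * (k * M ^ k * δ) + δ * M ^ k := by
            gcongr
            · exact hy v
            · exact hd v
        _ ≤ M * (k * M ^ k * δ) + δ * (M ^ k * M) := by
            gcongr; exact le_mul_of_one_le_right hMk hM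
        _ = _ := by push_cast; ring
    · rw [abs_mul, pow_succ, mul_comm]
      exact mul_le_mul h2 (hy' v) (abs_nonneg _) hMk

lemma poly_dev {n d : ℕ} (c : Multiset (Fin n ⊕ Fin n) →₀ ℝ)
    (hc : ∀ S ∈ c.support, Multiset.card S ≤ d)
    (y y' : Fin n ⊕ Fin n → ℝ) (M δ : ℝ) (hM : 1 ≤ M) (hδ : 0 ≤ δ)
    (hy : ∀ v, |y v| ≤ M) (hy' : ∀ v, |y' v| ≤ M) (hd : ∀ v, |y v - y' v| ≤ δ) :
    |polyEval c y - polyEval c y'| ≤ d * M ^ d * δ * weight c := by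
  unfold polyEval weight
  rw [← Finset.sum_sub_distrib, Finset.mul_sum]
  refine (Finset.abs_sum_le_sum_abs _ _).trans (Finset.sum_le_sum ?_)
  intro S hS
  rw [← mul_sub, abs_mul]
  by_cases h0 : S = 0
  · subst h0; simp
  · rw [if_neg h0, mul_comm]
    have h1 := (prod_dev y y' M δ hM hδ hy hy' hd S).1
    have h2 : (Multiset.card S : ℝ) ≤ d := by exact_mod_cast hc S hS
    have h3 : M ^ Multiset.card S ≤ M ^ d := pow_le_pow_right₀ hM (hc S hS)
    have h4 : 0 ≤ M ^ Multiset.card S := by positivity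
    gcongr
    refine h1.trans ?_
    gcongr

lemma flip_small {n d : ℕ} (hn : 1 ≤ n) (c : Multiset (Fin n ⊕ Fin n) →₀ ℝ)
    (hc : ∀ S ∈ c.support, Multiset.card S ≤ d) (a : Fin n → Bool) (h g : Fin n → ℝ)
    (hh : ∀ i, |h i| ≤ n) (hg : ∀ i, |g i| ≤ n)
    (hp : 0 < polyEval c (TdPoint d n (a, h, g, 1)))
    (hm : polyEval c (TdPoint d n (a, h, g, -1)) < 0) :
    |polyEval c (basePoint d n a h g)| ≤
      d * ((n : ℝ) + (n : ℝ) ^ d + 1) ^ d * ((2 : ℝ) ^ (n ^ 2))⁻¹ * weight c := by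
  have hδe : (2 : ℝ) ^ (-((n : ℤ) ^ 2)) = ((2 : ℝ) ^ (n ^ 2))⁻¹ := by
    rw [zpow_neg]; norm_cast
  set δ := ((2 : ℝ) ^ (n ^ 2))⁻¹ with hδ
  have hδ0 : 0 ≤ δ := by positivity
  have hδ1 : δ ≤ 1 := inv_le_one_of_one_le₀ (one_le_pow₀ (by norm_num))
  have hn1 : (1 : ℝ) ≤ n := by exact_mod_cast hn
  have hnd : 0 ≤ (n : ℝ) ^ d := by positivity
  have hgd : ∀ i, |g i ^ d| ≤ (n : ℝ) ^ d := fun i => by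
    rw [abs_pow]; exact pow_le_pow_left₀ (abs_nonneg _) (hg i) d
  have hif : ∀ i, |(if a i then h i else 0)| ≤ (n : ℝ) := fun i => by
    split_ifs
    · exact hh i
    · simp
  have key : ∀ b : ℝ, |b| = 1 →
      |polyEval c (TdPoint d n (a, h, g, b)) - polyEval c (basePoint d n a h g)| ≤
        d * ((n : ℝ) + (n : ℝ) ^ d + 1) ^ d * δ * weight c := by
    intro b hb
    have hbδ : |b * δ| = δ := by rw [abs_mul, hb, one_mul, abs_of_nonneg hδ0]
    apply poly_dev c hc _ _ _ _ (by linarith) hδ0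
    · rintro (i | i)
      · simp only [TdPoint, Sum.elim_inl, hδe]
        refine (abs_add_le _ _).trans ?_
        have := abs_add_le (if a i then h i else 0) (g i ^ d)
        linarith [hif i, hgd i]
      · simp only [TdPoint, Sum.elim_inr]
        linarith [hg i]
    · rintro (i | i)
      · simp only [basePoint, Sum.elim_inl]
        refine (abs_add_le _ _).trans ?_
        linarith [hif i, hgd i]
      · simp only [basePoint, Sum.elim_inr]
        linarith [hg i]
    · rintro (i | i)
      · simp only [TdPoint, basePoint, Sum.elim_inl, hδe, add_sub_cancel_left]
        exact hbδ.le
      · simp only [TdPoint, basePoint, Sum.elim_inr, sub_self, abs_zero]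
        exact hδ0
  have k1 := abs_le.mp (key 1 (by simp))
  have k2 := abs_le.mp (key (-1) (by simp))
  rw [abs_le]
  constructor <;> linarith [k1.1, k1.2, k2.1, k2.2]

end eval
section meas

instance signUnif_prob : IsProbabilityMeasure signUnif := by
  constructor
  simp [signUnif, ENNReal.inv_two_add_inv_two]

lemma bern_prob (p : ℝ) (h0 : 0 ≤ p) (h1 : p ≤ 1) : IsProbabilityMeasure (bernoulliBool p) := by
  constructor
  simp only [bernoulliBool, Measure.coe_add, Measure.coe_smul, Pi.add_apply, Pi.smul_apply,
    measure_univ, smul_eq_mul, mul_one]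
  rw [← ENNReal.ofReal_add h0 (by linarith)]
  simp

lemma meas_poly (d n : ℕ) (c : Multiset (Fin n ⊕ Fin n) →₀ ℝ) :
    Measurable (fun ω : (Fin n → Bool) × (Fin n → ℝ) × (Fin n → ℝ) × ℝ =>
      polyEval c (TdPoint d n ω)) := by
  simp_rw [polyEval_eq]
  have hv : ∀ v, Measurable (fun ω : (Fin n → Bool) × (Fin n → ℝ) × (Fin n → ℝ) × ℝ =>
      TdPoint d n ω v) := by
    rintro (i | i)
    · simp only [TdPoint, Sum.elim_inl]
      refine Measurable.add (Measurable.add (Measurable.ite ?_ (by fun_prop) (by fun_prop))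
        (by fun_prop)) (by fun_prop)
      have : Measurable (fun ω : (Fin n → Bool) × (Fin n → ℝ) × (Fin n → ℝ) × ℝ => ω.1 i) := by
        fun_prop
      exact this (measurableSet_singleton true)
    · simp only [TdPoint, Sum.elim_inr]
      fun_prop
  refine Finset.measurable_sum _ fun S _ => ?_
  refine Measurable.const_mul ?_ _
  exact Finset.measurable_prod _ fun v _ => (hv v).pow_const _

lemma tail_coord (n : ℕ) (r : ℝ) (hr : 0 < r) (i : Fin n) :
    stdGaussianPi n {x | r < |x i|} ≤ ENNReal.ofReal (1 / r ^ 2) := by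
  have hmp := measurePreserving_eval (fun _ : Fin n => gaussianReal 0 1) i
  have hm : MeasurableSet {x : ℝ | r < |x|} := measurableSet_lt measurable_const (by fun_prop)
  have := hmp.measure_preimage hm.nullMeasurableSet
  refine le_trans (le_of_eq ?_) (gauss_tail r hr)
  rw [← this]; rfl

lemma tail_all (n : ℕ) (r : ℝ) (hr : 0 < r) :
    stdGaussianPi n {x | ∃ i, r < |x i|} ≤ n * ENNReal.ofReal (1 / r ^ 2) := by
  have : {x : Fin n → ℝ | ∃ i, r < |x i|} = ⋃ i, {x | r < |x i|} := by ext x; simp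
  rw [this]
  refine (measure_iUnion_le _).trans ?_
  rw [tsum_fintype]
  refine (Finset.sum_le_sum fun i _ => tail_coord n r hr i).trans ?_
  simp

/-- the small-value set for a fixed `a` -/
def smallSet (d n : ℕ) (c : Multiset (Fin n ⊕ Fin n) →₀ ℝ) (ε : ℝ) (a : Fin n → Bool) :
    Set ((Fin n → ℝ) × (Fin n → ℝ)) :=
  {p | |∑ S ∈ c.support, c S * ((∏ i, (p.1 i + p.2 i ^ d) ^ (expE a S i)) *
    ∏ i, p.2 i ^ (expF d a S i))| ≤ ε ∧ ∀ i, |p.2 i| ≤ (n : ℝ)}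

/-- measurable superset of the passing set -/
def passSet (d n : ℕ) (c : Multiset (Fin n ⊕ Fin n) →₀ ℝ) :
    Set ((Fin n → Bool) × (Fin n → ℝ) × (Fin n → ℝ) × ℝ) :=
  {ω | (0 < polyEval c (TdPoint d n ω) ∧ ω.2.2.2 = 1) ∨
    (polyEval c (TdPoint d n ω) < 0 ∧ ω.2.2.2 = -1) ∨
    (polyEval c (TdPoint d n ω) = 0 ∧ ω.2.2.2 = 0)}

lemma passSet_meas (d n : ℕ) (c : Multiset (Fin n ⊕ Fin n) →₀ ℝ) :
    MeasurableSet (passSet d n c) := by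
  have hf := meas_poly d n c
  have hb : Measurable (fun ω : (Fin n → Bool) × (Fin n → ℝ) × (Fin n → ℝ) × ℝ => ω.2.2.2) := by
    fun_prop
  refine MeasurableSet.union ?_ (MeasurableSet.union ?_ ?_)
  · exact (measurableSet_lt measurable_const hf).inter (measurableSet_eq_fun hb measurable_const)
  · exact (measurableSet_lt hf measurable_const).inter (measurableSet_eq_fun hb measurable_const)
  · exact (measurableSet_eq_fun hf measurable_const).inter
      (measurableSet_eq_fun hb measurable_const)

lemma pass_sub (d n : ℕ) (c : Multiset (Fin n ⊕ Fin n) →₀ ℝ) :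
    {ω : (Fin n → Bool) × (Fin n → ℝ) × (Fin n → ℝ) × ℝ |
      Real.sign (polyEval c (TdPoint d n ω)) = ω.2.2.2} ⊆ passSet d n c := by
  intro ω hω
  have hω' : Real.sign (polyEval c (TdPoint d n ω)) = ω.2.2.2 := hω
  rcases lt_trichotomy (polyEval c (TdPoint d n ω)) 0 with h | h | h
  · rw [Real.sign_of_neg h] at hω'
    exact Or.inr (Or.inl ⟨h, hω'.symm⟩)
  · rw [h, Real.sign_zero] at hω'
    exact Or.inr (Or.inr ⟨h, hω'.symm⟩)
  · rw [Real.sign_of_pos h] at hω'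
    exact Or.inl ⟨h, hω'.symm⟩

lemma pass_slice {n d : ℕ} (hn : 1 ≤ n) (c : Multiset (Fin n ⊕ Fin n) →₀ ℝ)
    (hc : ∀ S ∈ c.support, Multiset.card S ≤ d) (a : Fin n → Bool) (ε : ℝ)
    (hε : ε = d * ((n : ℝ) + (n : ℝ) ^ d + 1) ^ d * ((2 : ℝ) ^ (n ^ 2))⁻¹ * weight c) :
    ((stdGaussianPi n).prod ((stdGaussianPi n).prod signUnif)) (Prod.mk a ⁻¹' passSet d n c)
      ≤ 2⁻¹ + 2⁻¹ * (((stdGaussianPi n).prod (stdGaussianPi n)) (smallSet d n c ε a) +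
        2 * (n * ENNReal.ofReal (1 / (n : ℝ) ^ 2))) := by
  have hn0 : (0 : ℝ) < n := by exact_mod_cast hn
  have hf := meas_poly d n c
  set fl : Set ((Fin n → ℝ) × (Fin n → ℝ)) := {p | 0 < polyEval c (TdPoint d n (a, p.1, p.2, 1)) ∧
    polyEval c (TdPoint d n (a, p.1, p.2, -1)) < 0} with hfl
  have hflm : MeasurableSet fl := by
    have h1 : Measurable (fun p : (Fin n → ℝ) × (Fin n → ℝ) =>
      polyEval c (TdPoint d n (a, p.1, p.2, 1))) := hf.comp (by fun_prop)
    have h2 : Measurable (fun p : (Fin n → ℝ) × (Fin n → ℝ) =>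
      polyEval c (TdPoint d n (a, p.1, p.2, -1))) := hf.comp (by fun_prop)
    exact (measurableSet_lt measurable_const h1).inter (measurableSet_lt h2 measurable_const)
  have hVm : MeasurableSet (Prod.mk a ⁻¹' passSet d n c) :=
    measurable_prodMk_left (passSet_meas d n c)
  have hstep : ((stdGaussianPi n).prod ((stdGaussianPi n).prod signUnif))
      (Prod.mk a ⁻¹' passSet d n c)
      ≤ 2⁻¹ + 2⁻¹ * ((stdGaussianPi n).prod (stdGaussianPi n)) fl := by
    have hpt : ∀ h g, signUnif {b | (a, h, g, b) ∈ passSet d n c}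
        ≤ 2⁻¹ + 2⁻¹ * Set.indicator fl 1 (h, g) := by
      intro h g
      have hbm : MeasurableSet {b | (a, h, g, b) ∈ passSet d n c} := by
        have : Measurable (fun b : ℝ => (a, h, g, b)) := by fun_prop
        exact this (passSet_meas d n c)
      simp only [signUnif, Measure.coe_add, Measure.coe_smul, Pi.add_apply, Pi.smul_apply,
        smul_eq_mul]
      rw [Measure.dirac_apply' _ hbm, Measure.dirac_apply' _ hbm]
      have e1 : (1 : ℝ) ∈ {b | (a, h, g, b) ∈ passSet d n c} ↔
          0 < polyEval c (TdPoint d n (a, h, g, 1)) := by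
        simp only [passSet, Set.mem_ofPred_eq]; norm_num
      have e2 : (-1 : ℝ) ∈ {b | (a, h, g, b) ∈ passSet d n c} ↔
          polyEval c (TdPoint d n (a, h, g, -1)) < 0 := by
        simp only [passSet, Set.mem_ofPred_eq]; norm_num
      by_cases c1 : 0 < polyEval c (TdPoint d n (a, h, g, 1))
      · by_cases c2 : polyEval c (TdPoint d n (a, h, g, -1)) < 0
        · have : (h, g) ∈ fl := ⟨c1, c2⟩
          rw [Set.indicator_of_mem this, Set.indicator_of_mem (e1.mpr c1),
            Set.indicator_of_mem (e2.mpr c2)]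
          simp
        · rw [Set.indicator_of_mem (e1.mpr c1), Set.indicator_of_notMem (mt e2.mp c2)]
          simp
      · rw [Set.indicator_of_notMem (mt e1.mp c1), mul_zero, zero_add]
        refine le_trans ?_ le_self_add
        by_cases c2 : polyEval c (TdPoint d n (a, h, g, -1)) < 0
        · rw [Set.indicator_of_mem (e2.mpr c2)]; simp
        · rw [Set.indicator_of_notMem (mt e2.mp c2)]; simp
    have hmeasF : Measurable (fun p : (Fin n → ℝ) × (Fin n → ℝ) =>
        (2⁻¹ : ℝ≥0∞) + 2⁻¹ * Set.indicator fl 1 p) :=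
      measurable_const.add ((measurable_one.indicator hflm).const_mul _)
    rw [Measure.prod_apply hVm]
    calc ∫⁻ h, ((stdGaussianPi n).prod signUnif) (Prod.mk h ⁻¹' (Prod.mk a ⁻¹' passSet d n c))
          ∂(stdGaussianPi n)
        ≤ ∫⁻ h, ∫⁻ g, (2⁻¹ + 2⁻¹ * Set.indicator fl 1 (h, g)) ∂(stdGaussianPi n)
            ∂(stdGaussianPi n) := by
          apply lintegral_mono
          intro h
          beta_reduce
          rw [Measure.prod_apply (measurable_prodMk_left hVm)]
          apply lintegral_mono
          intro g
          exact hpt h g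
      _ = ∫⁻ p, (2⁻¹ + 2⁻¹ * Set.indicator fl 1 p)
            ∂((stdGaussianPi n).prod (stdGaussianPi n)) := by
          rw [lintegral_prod _ hmeasF.aemeasurable]
      _ = _ := by
          rw [lintegral_add_left measurable_const,
            lintegral_const_mul _ (measurable_one.indicator hflm), lintegral_indicator_one hflm]
          simp
  refine hstep.trans ?_
  gcongr
  have hsub : fl ⊆ smallSet d n c ε a ∪
      ((Prod.fst ⁻¹' {x | ∃ i, (n : ℝ) < |x i|}) ∪ (Prod.snd ⁻¹' {x | ∃ i, (n : ℝ) < |x i|})) := by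
    rintro ⟨h, g⟩ ⟨h1, h2⟩
    by_cases hh : ∃ i, (n : ℝ) < |h i|
    · exact Or.inr (Or.inl hh)
    by_cases hg : ∃ i, (n : ℝ) < |g i|
    · exact Or.inr (Or.inr hg)
    push Not at hh hg
    left
    refine ⟨?_, hg⟩
    have := flip_small hn c hc a h g hh hg h1 h2
    rw [polyEval_base, ← hε] at this
    exact this
  refine (measure_mono hsub).trans ((measure_union_le _ _).trans ?_)
  gcongr
  refine (measure_union_le _ _).trans ?_
  have hm : MeasurableSet {x : Fin n → ℝ | ∃ i, (n : ℝ) < |x i|} := by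
    have : {x : Fin n → ℝ | ∃ i, (n : ℝ) < |x i|} = ⋃ i, {x | (n : ℝ) < |x i|} := by ext x; simp
    rw [this]
    exact MeasurableSet.iUnion fun i => measurableSet_lt measurable_const (by fun_prop)
  rw [(measurePreserving_fst (μ := stdGaussianPi n) (ν := stdGaussianPi n)).measure_preimage
      hm.nullMeasurableSet,
    (measurePreserving_snd (μ := stdGaussianPi n) (ν := stdGaussianPi n)).measure_preimage
      hm.nullMeasurableSet, two_mul]
  exact add_le_add (tail_all n n hn0) (tail_all n n hn0)

lemma good_prob {n d : ℕ} (hn : 1 ≤ n) (hl : 1 ≤ Real.log n)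
    (c : Multiset (Fin n ⊕ Fin n) →₀ ℝ)
    (hc : ∀ S ∈ c.support, Multiset.card S ≤ d) (ε : ℝ)
    (hε : ε = d * ((n : ℝ) + (n : ℝ) ^ d + 1) ^ d * ((2 : ℝ) ^ (n ^ 2))⁻¹ * weight c)
    (θ : ℝ≥0∞)
    (hpass : ENNReal.ofReal (1 / 2 + 1 / Real.log n) ≤
        TdMeasure n {ω | Real.sign (polyEval c (TdPoint d n ω)) = ω.2.2.2}) :
    ENNReal.ofReal (1 / 2 + 1 / Real.log n) ≤ 2⁻¹ + 2⁻¹ * ((θ +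
      (Measure.pi fun _ : Fin n => bernoulliBool (1 / Real.log n))
        {a | θ < ((stdGaussianPi n).prod (stdGaussianPi n)) (smallSet d n c ε a)})
      + 2 * (n * ENNReal.ofReal (1 / (n : ℝ) ^ 2))) := by
  have hb0 : 0 ≤ 1 / Real.log n := by positivity
  have hb1 : 1 / Real.log n ≤ 1 := by
    rw [div_le_one (by linarith)]; exact hl
  have := bern_prob _ hb0 hb1
  set Pm := (Measure.pi fun _ : Fin n => bernoulliBool (1 / Real.log n)) with hPm
  set G := {a | θ < ((stdGaussianPi n).prod (stdGaussianPi n)) (smallSet d n c ε a)} with hG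
  have hGm : MeasurableSet G := (Set.toFinite G).measurableSet
  refine hpass.trans ((measure_mono (pass_sub d n c)).trans ?_)
  unfold TdMeasure
  rw [Measure.prod_apply (passSet_meas d n c)]
  set t := 2 * (n * ENNReal.ofReal (1 / (n : ℝ) ^ 2)) with ht
  calc _ ≤ ∫⁻ a, (2⁻¹ + 2⁻¹ * ((θ + Set.indicator G 1 a) + t)) ∂Pm := by
        apply lintegral_mono
        intro a
        refine (pass_slice hn c hc a ε hε).trans ?_
        refine add_le_add le_rfl (mul_le_mul_right (add_le_add ?_ le_rfl) _)
        by_cases ha : a ∈ G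
        · rw [Set.indicator_of_mem ha]
          exact prob_le_one.trans le_add_self
        · rw [Set.indicator_of_notMem ha, add_zero]
          exact not_lt.mp ha
    _ = _ := by
        have hi : Measurable (Set.indicator G (1 : (Fin n → Bool) → ℝ≥0∞)) :=
          measurable_one.indicator hGm
        have hm3 : Measurable (fun a => θ + Set.indicator G (1 : (Fin n → Bool) → ℝ≥0∞) a + t) :=
          (measurable_const.add hi).add measurable_const
        rw [lintegral_add_left measurable_const, lintegral_const_mul _ hm3,
          lintegral_add_right _ measurable_const, lintegral_add_left measurable_const,
          lintegral_indicator_one hGm]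
        simp

lemma avoid_prob {n : ℕ} (hn : 1 ≤ n) (hl : 1 ≤ Real.log n) (I : Finset (Fin n))
    (hI : (Real.log n) ^ 2 < I.card) (G : Set (Fin n → Bool))
    (hG : ∀ a ∈ G, ∀ i ∈ I, a i = false) :
    (Measure.pi fun _ : Fin n => bernoulliBool (1 / Real.log n)) G ≤ ENNReal.ofReal (1 / n) := by
  have hb0 : 0 ≤ 1 / Real.log n := by positivity
  have hb1 : 1 / Real.log n ≤ 1 := by
    rw [div_le_one (by linarith)]; exact hl
  have := bern_prob _ hb0 hb1
  have hn0 : (0 : ℝ) < n := by exact_mod_cast hn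
  have hsub : G ⊆ Set.pi Set.univ (fun i => if i ∈ I then {false} else Set.univ) := by
    intro a ha i _
    beta_reduce
    split_ifs with hi
    · exact hG a ha i hi
    · trivial
  refine (measure_mono hsub).trans ?_
  rw [Measure.pi_pi]
  have hone : ∀ i : Fin n, bernoulliBool (1 / Real.log n) (if i ∈ I then {false} else Set.univ)
      = if i ∈ I then ENNReal.ofReal (1 - 1 / Real.log n) else 1 := by
    intro i
    split_ifs
    · simp [bernoulliBool]
    · exact measure_univ
  simp_rw [hone]
  rw [Finset.prod_ite_mem, Finset.univ_inter, Finset.prod_const,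
    ← ENNReal.ofReal_pow (by linarith)]
  apply ENNReal.ofReal_le_ofReal
  have h1 : 1 - 1 / Real.log n ≤ Real.exp (-(1 / Real.log n)) := by
    have := Real.add_one_le_exp (-(1 / Real.log n)); linarith
  calc (1 - 1 / Real.log n) ^ I.card ≤ (Real.exp (-(1 / Real.log n))) ^ I.card :=
        pow_le_pow_left₀ (by linarith) h1 _
    _ = Real.exp (-(I.card / Real.log n)) := by
        rw [← Real.exp_nat_mul]; congr 1; ring
    _ ≤ Real.exp (-Real.log n) := by
        apply Real.exp_le_exp.mpr
        rw [neg_le_neg_iff, le_div_iff₀ (by linarith)]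
        nlinarith
    _ = 1 / n := by rw [Real.exp_neg, Real.exp_log hn0, one_div]

end meas

/-- Soundness of the dictator test `T_d` (Lemma 3.2): for sufficiently large
`n`, if a degree-`d` polynomial of positive weight passes `T_d` with probability
at least `1/2 + β` (`β = 1/log n`), then `|I_{0.5}(f₁)| ≤ 1/β²`,
`|I_1(f₂)| ≤ 1/β²`, and every `i` with `n+i ∈ I_1(f₂)` has `i ∈ I_{0.5}(f₁)`. -/
theorem stmt4 (d : ℕ) (hd : 1 ≤ d) :
    ∃ N : ℕ, ∀ n ≥ N, ∀ c : Multiset (Fin n ⊕ Fin n) →₀ ℝ,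
      (∀ S ∈ c.support, Multiset.card S ≤ d) →
      0 < weight c →
      ENNReal.ofReal (1 / 2 + 1 / Real.log n) ≤
        TdMeasure n {ω | Real.sign (polyEval c (TdPoint d n ω)) = ω.2.2.2} →
      ((ILeft d (0.5) c).ncard : ℝ) ≤ 1 / (1 / Real.log n) ^ 2 ∧
      ((IRight d 1 c).ncard : ℝ) ≤ 1 / (1 / Real.log n) ^ 2 ∧
      ∀ i : Fin n, i ∈ IRight d 1 c → i ∈ ILeft d (0.5) c := by
  obtain ⟨N, hN⟩ := numeric d (2 * d ^ 2) hd (by nlinarith)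
  refine ⟨max N ((d + 1) ^ 2 + 4), fun n hn c hc hW hpass => ?_⟩
  obtain ⟨hn3, hlog, -, hl, hnum⟩ := hN n (le_trans (le_max_left _ _) hn)
  have hnd : (d + 1) ^ 2 + 4 ≤ n := le_trans (le_max_right _ _) hn
  have hn1 : 1 ≤ n := by omega
  have hnr : (0 : ℝ) < n := by exact_mod_cast hn1
  set D := 2 * d ^ 2 with hD
  have hD1 : 1 ≤ D := by rw [hD]; nlinarith
  have hDr : (0 : ℝ) < D := by exact_mod_cast hD1
  set ε := d * ((n : ℝ) + (n : ℝ) ^ d + 1) ^ d * ((2 : ℝ) ^ (n ^ 2))⁻¹ * weight c with hε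
  have hε0 : 0 ≤ ε := by positivity
  set ρ : ℝ := 1 / (2 * D * (n : ℝ) ^ 2) with hρ
  have hρ0 : 0 < ρ := by positivity
  set η : ℝ≥0∞ := ENNReal.ofReal (2 / (n : ℝ) ^ 2) with hη
  have hη' : (D : ℝ≥0∞) * ENNReal.ofReal (2 * ρ) + ENNReal.ofReal (1 / (n : ℝ) ^ 2) ≤ η := by
    rw [hη, ← ENNReal.ofReal_natCast, ← ENNReal.ofReal_mul (by positivity),
      ← ENNReal.ofReal_add (by positivity) (by positivity)]
    apply ENNReal.ofReal_le_ofReal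
    apply le_of_eq
    rw [hρ]; field_simp; norm_num
  set K := ((1 + 2 * (1 + ((n : ℝ) + (n : ℝ) ^ d)) / ρ) ^ D) ^ (2 * n) with hK
  have hK0 : 0 ≤ K := by positivity
  set τ := ε * K with hτ
  have hτ0 : 0 ≤ τ := by positivity
  set θ : ℝ≥0∞ := 2 * (n * η) with hθ
  set Pm := (Measure.pi fun _ : Fin n => bernoulliBool (1 / Real.log n)) with hPm
  set G := {a | θ < ((stdGaussianPi n).prod (stdGaussianPi n)) (smallSet d n c ε a)} with hG
  have hgp := good_prob hn1 hl c hc ε hε θ hpass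
  have hcount : ∀ S ∈ c.support, ∀ v, S.count v ≤ d := fun S hS v =>
    (Multiset.count_le_card v S).trans (hc S hS)
  have hgood : ∀ a ∈ G, (∀ S, τ < |c S| → ∃ i, a i = false ∧
      (S = {Sum.inl i} ∨ S = Multiset.replicate d (Sum.inr i))) ∧
      (∀ i, a i = false → |c {Sum.inl i} + c (Multiset.replicate d (Sum.inr i))| ≤ τ) := by
    intro a ha
    apply good_coef hd a c hc τ
    intro k l
    refine ac2 ρ n ((n : ℝ) ^ d) hρ0 hnr (by positivity) D d η hη' le_rfl n c.support c
      (expE a) (expF d a) ?_ ?_ ε hε0 ha k l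
    · intro S hS i
      have := hcount S hS (Sum.inl i)
      simp only [expE]
      split_ifs <;> nlinarith
    · intro S hS i
      have h1 := hcount S hS (Sum.inl i)
      have h2 := hcount S hS (Sum.inr i)
      have h3 : d * S.count (Sum.inl i) ≤ d * d := Nat.mul_le_mul_left d h1
      simp only [expF]
      split_ifs <;> nlinarith
  -- numeric bounds
  have hX : ∀ X : ℝ, 0 ≤ X → X ≤ 2 * (n : ℝ) ^ n → 100 * (X * τ) ≤ weight c := by
    intro X h0 h1
    have := hnum X h0 h1
    calc 100 * (X * τ) = (100 * (X * ((d * ((n : ℝ) + (n : ℝ) ^ d + 1) ^ d *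
          ((2 : ℝ) ^ (n ^ 2))⁻¹) * K))) * weight c := by rw [hτ, hε]; ring
      _ ≤ 1 * weight c := by gcongr
      _ = weight c := one_mul _
  have hN1 : 100 * ((c.support.card + n) * τ) ≤ weight c := by
    apply hX _ (by positivity)
    have h1 : c.support.card + n ≤ 2 * n ^ n := by
      have h2 := supp_card c hc
      have h3 : (d + 1) ^ (2 * n) ≤ n ^ n := by
        rw [pow_mul]; exact Nat.pow_le_pow_left (by omega) n
      have h4 : n ≤ n ^ n := Nat.le_self_pow (by omega) n
      omega
    exact_mod_cast h1
  have hC1 : 100 * ((Nat.choose (n + d) d : ℝ) * τ) ≤ weight c := by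
    apply hX _ (by positivity)
    have h1 : Nat.choose (n + d) d ≤ 2 * n ^ n := by
      have h2 : Nat.choose (n + d) d ≤ 2 ^ (n + d) := Nat.choose_le_two_pow _ _
      have h3 : 2 ^ (n + d) ≤ 2 ^ (2 * n) := Nat.pow_le_pow_right (by norm_num) (by nlinarith)
      have h4 : 2 ^ (2 * n) ≤ n ^ n := by
        rw [pow_mul]; exact Nat.pow_le_pow_left (by omega) n
      omega
    exact_mod_cast h1
  -- probability of good
  have hGp : ¬ Pm G ≤ ENNReal.ofReal (1 / n) := by
    intro hle
    have h1 : ENNReal.ofReal (1 / 2 + 1 / Real.log n) ≤ ENNReal.ofReal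
        (2⁻¹ + 2⁻¹ * ((2 * (n * (2 / (n : ℝ) ^ 2)) + 1 / n) + 2 * (n * (1 / (n : ℝ) ^ 2)))) := by
      refine hgp.trans ?_
      rw [ENNReal.ofReal_add (by positivity) (by positivity),
        ENNReal.ofReal_mul (by positivity),
        ENNReal.ofReal_add (by positivity) (by positivity),
        ENNReal.ofReal_add (by positivity) (by positivity),
        ENNReal.ofReal_mul (p := 2) (by positivity), ENNReal.ofReal_mul (p := (n : ℝ)) (by positivity),
        ENNReal.ofReal_mul (p := 2) (by positivity), ENNReal.ofReal_mul (p := (n : ℝ)) (by positivity),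
        ENNReal.ofReal_natCast, ENNReal.ofReal_inv_of_pos (by norm_num)]
      simp only [ENNReal.ofReal_ofNat]
      gcongr
    rw [ENNReal.ofReal_le_ofReal_iff (by positivity)] at h1
    have h2 : 2⁻¹ + 2⁻¹ * ((2 * (n * (2 / (n : ℝ) ^ 2)) + 1 / n) + 2 * (n * (1 / (n : ℝ) ^ 2)))
        = 1 / 2 + 7 / (2 * n) := by field_simp; ring
    rw [h2] at h1
    have h3 : 1 / Real.log n ≤ 7 / (2 * n) := by linarith
    rw [div_le_div_iff₀ (by linarith) (by positivity)] at h3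
    linarith
  have hGne : G.Nonempty := by
    rw [Set.nonempty_iff_ne_empty]; intro h0; apply hGp; rw [h0]; simp
  have hsq : 1 / (1 / Real.log n) ^ 2 = (Real.log n) ^ 2 := by field_simp
  have hLs : ∀ a ∈ G, ∀ i ∈ ILeft d 0.5 c, a i = false := by
    rintro a ha i ⟨S, hiS, hSl, hS⟩
    obtain ⟨H1, H2⟩ := hgood a ha
    obtain ⟨w1, w2, w3⟩ := weights hd a c τ hτ0 H1 H2 hW hN1 hC1
    obtain ⟨j, hj, h | h⟩ := H1 S (w1.trans_le hS)
    · rw [h] at hiS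
      have : i = j := by simpa using hiS
      rw [this]; exact hj
    · rw [h] at hiS
      simpa using Multiset.eq_of_mem_replicate hiS
  have hRs' : ∀ a ∈ G, ∀ i ∈ IRight d 1 c, a i = false ∧ i ∈ ILeft d 0.5 c := by
    rintro a ha i ⟨S, hiS, hSl, hS⟩
    obtain ⟨H1, H2⟩ := hgood a ha
    obtain ⟨w1, w2, w3⟩ := weights hd a c τ hτ0 H1 H2 hW hN1 hC1
    obtain ⟨j, hj, h | h⟩ := H1 S (w2.trans_le hS)
    · rw [h] at hiS
      simp at hiS
    · rw [h] at hiS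
      have hij : i = j := by simpa using Multiset.eq_of_mem_replicate hiS
      rw [← hij] at hj h
      refine ⟨hj, {Sum.inl i}, by simp, by simp, ?_⟩
      have h2 := H2 i hj
      rw [h] at hS
      have h3 := abs_abs_sub_abs_le (c {Sum.inl i}) (-c (Multiset.replicate d (Sum.inr i)))
      rw [sub_neg_eq_add, abs_neg] at h3
      have h4 := abs_le.mp (h3.trans h2)
      linarith [h4.1]
  have hfin : ∀ I : Set (Fin n), (∀ a ∈ G, ∀ i ∈ I, a i = false) →
      (I.ncard : ℝ) ≤ 1 / (1 / Real.log n) ^ 2 := by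
    intro I hI
    rw [hsq]
    by_contra hcon
    push Not at hcon
    apply hGp
    rw [Set.ncard_eq_toFinset_card I (Set.toFinite I)] at hcon
    refine avoid_prob hn1 hl _ hcon G ?_
    intro a ha i hi
    exact hI a ha i (by simpa using hi)
  obtain ⟨a₀, ha₀⟩ := hGne
  exact ⟨hfin _ hLs, hfin _ (fun a ha i hi => (hRs' a ha i hi).1),
    fun i hi => (hRs' a₀ ha₀ i hi).2⟩
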